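/- For every dimension n ≥ 1 there exist, for each integer k ≥ 0, a finite family of vectors ω_{i,k} ∈ ℝ^n (i ∈ I_k) with 1/2 ≤ |ω_{i,k}| < 1, such that for every real m ≥ 0 there are constants 0 < C₁' ≤ C₂' < ∞ with: for every ξ ∈ ℝ^n with |ξ| ≥ 1/2, C₁'|ξ|^{2m} ≤ Σ_{k≥0} Σ_{i∈I_k} 2^{2km} exp(−|ξ − 2^k ω_{i,k}|²/(2·2^k|ω_{i,k}|)) ≤ C₂'|ξ|^{2m}. -/

import Mathlib

open Finset in
/-- One point of the annulus in each lattice cell (of side `1 / s`) meeting the annulus. -/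
lemma gpu_exists_net (n : ℕ) (s : ℝ) (hs : 0 ≤ s) :
    ∃ W : Finset (EuclideanSpace ℝ (Fin n)),
      (∀ v ∈ W, 1 / 2 ≤ ‖v‖ ∧ ‖v‖ < 1) ∧
      (∀ v ∈ W, ∀ w ∈ W, (fun i => ⌊s * v i⌋) = (fun i => ⌊s * w i⌋) → v = w) ∧
      ∀ v : EuclideanSpace ℝ (Fin n), 1 / 2 ≤ ‖v‖ → ‖v‖ < 1 →
        ∃ w ∈ W, (fun i => ⌊s * w i⌋) = (fun i => ⌊s * v i⌋) := by
  classical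
  set A : Set (EuclideanSpace ℝ (Fin n)) := {v | 1 / 2 ≤ ‖v‖ ∧ ‖v‖ < 1} with hA
  set c : EuclideanSpace ℝ (Fin n) → (Fin n → ℤ) := fun v i => ⌊s * v i⌋ with hc
  obtain ⟨W, hWA, hW⟩ := (Set.surjOn_image c A).exists_bijOn_subset
  have hfin : (c '' A).Finite := by
    refine (Set.finite_Icc (fun _ => ⌊-s⌋) (fun _ => ⌊s⌋)).subset ?_
    rintro _ ⟨v, hv, rfl⟩
    have h1 : ∀ i, |v i| ≤ 1 := fun i => by
      have := PiLp.norm_apply_le v i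
      rw [Real.norm_eq_abs] at this
      exact this.trans hv.2.le
    constructor
    · intro i
      apply Int.floor_le_floor
      nlinarith [abs_le.1 (h1 i)]
    · intro i
      apply Int.floor_le_floor
      nlinarith [abs_le.1 (h1 i)]
  have hWfin : W.Finite := by
    apply Set.Finite.of_finite_image _ hW.injOn
    rw [hW.image_eq]; exact hfin
  refine ⟨hWfin.toFinset, ?_, ?_, ?_⟩
  · intro v hv
    exact hWA (hWfin.mem_toFinset.1 hv)
  · intro v hv w hw h
    exact hW.injOn (hWfin.mem_toFinset.1 hv) (hWfin.mem_toFinset.1 hw) h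
  · intro v h1 h2
    obtain ⟨w, hw, h⟩ := hW.surjOn (Set.mem_image_of_mem c (show v ∈ A from ⟨h1, h2⟩))
    exact ⟨w, hWfin.mem_toFinset.2 hw, h⟩

/-- The one-dimensional majorant is summable over the integers. -/
lemma gpu_summable_int :
    Summable (fun d : ℤ => Real.exp (3 / 4) * Real.exp (-(|(d : ℝ)| / 2))) := by
  apply Summable.mul_left
  have h : Summable (fun j : ℕ => Real.exp (-((j : ℝ) / 2))) := by
    have := Real.summable_exp_nat_mul_iff.2 (show (-(1 / 2) : ℝ) < 0 by norm_num)
    refine this.congr fun j => ?_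
    congr 1; ring
  apply Summable.of_nat_of_neg
  · simpa using h
  · simpa using h

lemma gpu_coord (a b : ℝ) :
    Real.exp (-((a - b) ^ 2 / 4)) ≤
      Real.exp (3 / 4) * Real.exp (-(|((⌊b⌋ - ⌊a⌋ : ℤ) : ℝ)| / 2)) := by
  rw [← Real.exp_add]
  apply Real.exp_le_exp.2
  have h : |((⌊b⌋ - ⌊a⌋ : ℤ) : ℝ)| ≤ |a - b| + 1 := by
    push_cast
    have h1 := Int.floor_le a
    have h2 := Int.lt_floor_add_one a
    have h3 := Int.floor_le b
    have h4 := Int.lt_floor_add_one b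
    apply abs_le.2
    constructor
    · linarith [le_abs_self (a - b)]
    · linarith [neg_abs_le (a - b)]
  nlinarith [sq_abs (a - b), sq_nonneg (|a - b| - 1)]

/-- Uniform bound on Gaussian sums over nets. -/
lemma gpu_gauss_sum (n : ℕ) (s : ℝ) (W : Finset (EuclideanSpace ℝ (Fin n)))
    (hW : ∀ v ∈ W, ∀ w ∈ W, (fun i => ⌊s * v i⌋) = (fun i => ⌊s * w i⌋) → v = w)
    (y : EuclideanSpace ℝ (Fin n)) :
    ∑ v ∈ W, Real.exp (-(‖y - s • v‖ ^ 2 / 4)) ≤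
      (∑' d : ℤ, Real.exp (3 / 4) * Real.exp (-(|(d : ℝ)| / 2))) ^ n := by
  classical
  set g : ℤ → ℝ := fun d => Real.exp (3 / 4) * Real.exp (-(|(d : ℝ)| / 2)) with hg
  have hg0 : ∀ d, 0 ≤ g d := fun d => by positivity
  set c : EuclideanSpace ℝ (Fin n) → (Fin n → ℤ) := fun v i => ⌊s * v i⌋ - ⌊y i⌋ with hc
  have hinj : Set.InjOn c W := by
    intro v hv w hw h
    apply hW v hv w hw
    funext i
    have := congrFun h i
    simp only [hc] at this
    linarith
  have h1 : ∀ v ∈ W, Real.exp (-(‖y - s • v‖ ^ 2 / 4)) ≤ ∏ i, g (c v i) := by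
    intro v _
    have : -(‖y - s • v‖ ^ 2 / 4) = ∑ i, (-((y i - s * v i) ^ 2 / 4)) := by
      rw [EuclideanSpace.norm_sq_eq, Finset.sum_neg_distrib, Finset.sum_div]
      simp [sq_abs]
    rw [this, Real.exp_sum]
    exact Finset.prod_le_prod (fun i _ => (Real.exp_pos _).le) (fun i _ => gpu_coord _ _)
  set t : Fin n → Finset ℤ := fun i => W.image (fun v => c v i) with ht
  calc _ ≤ ∑ v ∈ W, ∏ i, g (c v i) := Finset.sum_le_sum h1
    _ = ∑ z ∈ W.image c, ∏ i, g (z i) :=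
        (Finset.sum_image (f := fun z : Fin n → ℤ => ∏ i, g (z i)) hinj).symm
    _ ≤ ∑ z ∈ Fintype.piFinset t, ∏ i, g (z i) := by
        apply Finset.sum_le_sum_of_subset_of_nonneg
        · intro z hz
          obtain ⟨v, hv, rfl⟩ := Finset.mem_image.1 hz
          exact Fintype.mem_piFinset.2 fun i => Finset.mem_image_of_mem _ hv
        · intro z _ _
          exact Finset.prod_nonneg fun i _ => hg0 _
    _ = ∏ i, ∑ d ∈ t i, g d := (Finset.prod_univ_sum t (fun _ d => g d)).symm
    _ ≤ ∏ _i : Fin n, ∑' d, g d := by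
        apply Finset.prod_le_prod
        · intro i _; exact Finset.sum_nonneg fun d _ => hg0 d
        · intro i _; exact gpu_summable_int.sum_le_tsum _ (fun d _ => hg0 d)
    _ = _ := by simp

lemma gpu_summable_dyadic (m : ℝ) :
    Summable (fun k : ℕ => (2 : ℝ) ^ (2 * (k : ℝ) * m) * Real.exp (-((2 : ℝ) ^ k / 64))) := by
  have h := Real.summable_pow_mul_exp_neg_nat_mul ⌈2 * m⌉₊ (show (0 : ℝ) < 1 / 64 by norm_num)
  have h2 := h.comp_injective (Nat.pow_right_injective (le_refl 2))
  refine Summable.of_nonneg_of_le (fun k => by positivity) (fun k => ?_) h2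
  simp only [Function.comp]
  push_cast
  have e : (-((2 : ℝ) ^ k / 64)) = -(1 / 64) * 2 ^ k := by ring
  rw [e]
  apply mul_le_mul_of_nonneg_right _ (Real.exp_pos _).le
  rw [← Real.rpow_natCast, ← Real.rpow_natCast, ← Real.rpow_mul (by norm_num)]
  apply Real.rpow_le_rpow_of_exponent_le (by norm_num)
  nlinarith [Nat.le_ceil (2 * m), (Nat.cast_nonneg k : (0 : ℝ) ≤ k)]

/-- Off the three resonant scales, the Gaussian has an extra exponential decay. -/
lemma gpu_far {E : Type*} [NormedAddCommGroup E] (R : ℝ) (hR : 0 < R) (ξ p : E)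
    (h1 : R / 2 ≤ ‖p‖) (h2 : ‖p‖ < R) (h : R ≤ ‖ξ‖ / 2 ∨ 4 * ‖ξ‖ ≤ R) :
    Real.exp (-(‖ξ - p‖ ^ 2 / (4 * R))) ≤ Real.exp (-(R / 64)) := by
  apply Real.exp_le_exp.2
  have h3 := norm_sub_norm_le ξ p
  have h4 := norm_sub_norm_le p ξ
  rw [norm_sub_rev] at h4
  have h5 : R / 4 ≤ ‖ξ - p‖ := by
    rcases h with h | h <;> linarith
  have : R / 64 ≤ ‖ξ - p‖ ^ 2 / (4 * R) := by
    rw [le_div_iff₀ (by positivity)]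
    nlinarith
  linarith

lemma gpu_scale (n : ℕ) (s : ℝ) (hs : 0 < s) (ξ v : EuclideanSpace ℝ (Fin n)) :
    ‖ξ - (s ^ 2) • v‖ ^ 2 = s ^ 2 * ‖s⁻¹ • ξ - s • v‖ ^ 2 := by
  have : ξ - (s ^ 2) • v = s • (s⁻¹ • ξ - s • v) := by
    rw [smul_sub, smul_smul, smul_smul, mul_inv_cancel₀ hs.ne', one_smul, pow_two]
  rw [this, norm_smul, mul_pow, Real.norm_eq_abs, sq_abs]

/-- Lemma 1 of the paper: an approximate partition of unity built from real Gaussians centered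
at the points `2^k ω_{i,k}` in the dyadic annuli, valid on the region `|ξ| ≥ 1/2`. -/
theorem gaussian_partition_of_unity (n : ℕ) (hn : 1 ≤ n) :
    ∃ ω : ℕ → Finset (EuclideanSpace ℝ (Fin n)),
      (∀ k, ∀ v ∈ ω k, 1 / 2 ≤ ‖v‖ ∧ ‖v‖ < 1) ∧
      ∀ m : ℝ, 0 ≤ m →
        ∃ C₁ C₂ : ℝ, 0 < C₁ ∧ C₁ ≤ C₂ ∧
          ∀ ξ : EuclideanSpace ℝ (Fin n), 1 / 2 ≤ ‖ξ‖ →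
            ENNReal.ofReal (C₁ * ‖ξ‖ ^ (2 * m)) ≤
              (∑' k : ℕ, ∑ v ∈ ω k, ENNReal.ofReal ((2 : ℝ) ^ (2 * (k : ℝ) * m) *
                Real.exp (-‖ξ - (2 : ℝ) ^ k • v‖ ^ 2 / (2 * ((2 : ℝ) ^ k * ‖v‖))))) ∧
            (∑' k : ℕ, ∑ v ∈ ω k, ENNReal.ofReal ((2 : ℝ) ^ (2 * (k : ℝ) * m) *
                Real.exp (-‖ξ - (2 : ℝ) ^ k • v‖ ^ 2 / (2 * ((2 : ℝ) ^ k * ‖v‖))))) ≤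
              ENNReal.ofReal (C₂ * ‖ξ‖ ^ (2 * m)) := by
  classical
  set s : ℕ → ℝ := fun k => √2 ^ k with hs
  have hs0 : ∀ k, 0 < s k := fun k => by positivity
  have hs2 : ∀ k, (2 : ℝ) ^ k = s k ^ 2 := fun k => by
    simp only [hs]
    rw [← pow_mul, mul_comm, pow_mul, Real.sq_sqrt (by norm_num)]
  choose ω hωA hωinj hωcov using fun k => gpu_exists_net n (s k) (hs0 k).le
  refine ⟨ω, hωA, fun m hm => ?_⟩
  set K : ℝ := (∑' d : ℤ, Real.exp (3 / 4) * Real.exp (-(|(d : ℝ)| / 2))) ^ n with hK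
  have hK0 : 0 ≤ K := pow_nonneg (tsum_nonneg fun d => by positivity) n
  set b : ℕ → ℝ := fun k => (2 : ℝ) ^ (2 * (k : ℝ) * m) * Real.exp (-((2 : ℝ) ^ k / 64)) with hb
  have hb0 : ∀ k, 0 ≤ b k := fun k => by positivity
  have hbs : Summable b := gpu_summable_dyadic m
  set S : ℝ := ∑' k, b k with hS
  have hS0 : 0 ≤ S := tsum_nonneg hb0
  have h2km : ∀ k : ℕ, (2 : ℝ) ^ (2 * (k : ℝ) * m) = ((2 : ℝ) ^ k) ^ (2 * m) := fun k => by
    rw [← Real.rpow_natCast, ← Real.rpow_mul (by norm_num)]; congr 1; ring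
  refine ⟨Real.exp (-n), K * (3 * 4 ^ (2 * m) + S * 2 ^ (2 * m)) + Real.exp (-n),
    Real.exp_pos _, le_add_of_nonneg_left (by positivity), fun ξ hξ => ?_⟩
  have hξ0 : 0 < ‖ξ‖ := by linarith
  obtain ⟨k₀, hk1, hk2⟩ := exists_nat_pow_near (show 1 ≤ 2 * ‖ξ‖ by linarith) (one_lt_two)
  rw [pow_succ] at hk2
  constructor
  · -- lower bound
    have hR : (0 : ℝ) < 2 ^ k₀ := by positivity
    have hv : ‖((2 : ℝ) ^ k₀)⁻¹ • ξ‖ = ‖ξ‖ / 2 ^ k₀ := by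
      rw [norm_smul, norm_inv, Real.norm_of_nonneg hR.le]; field_simp
    obtain ⟨w, hw, hcell⟩ := hωcov k₀ (((2 : ℝ) ^ k₀)⁻¹ • ξ)
      (by rw [hv, le_div_iff₀ hR]; linarith) (by rw [hv, div_lt_one hR]; linarith)
    refine le_trans ?_ (ENNReal.le_tsum k₀)
    refine le_trans ?_ (Finset.single_le_sum (f := fun v => ENNReal.ofReal
      ((2 : ℝ) ^ (2 * (k₀ : ℝ) * m) *
        Real.exp (-‖ξ - (2 : ℝ) ^ k₀ • v‖ ^ 2 / (2 * ((2 : ℝ) ^ k₀ * ‖v‖)))))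
      (fun _ _ => bot_le) hw)
    apply ENNReal.ofReal_le_ofReal
    rw [mul_comm]
    have hdist : ‖(s k₀)⁻¹ • ξ - s k₀ • w‖ ^ 2 ≤ n := by
      rw [EuclideanSpace.norm_sq_eq]
      calc _ ≤ ∑ _i : Fin n, (1 : ℝ) := by
            apply Finset.sum_le_sum
            intro i _
            have hi := congrFun hcell i
            simp only [PiLp.smul_apply, smul_eq_mul] at hi
            have e : s k₀ * (((2 : ℝ) ^ k₀)⁻¹ * ξ i) = (s k₀)⁻¹ * ξ i := by
              rw [hs2]; have := (hs0 k₀).ne'; field_simp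
            rw [e] at hi
            have := Int.abs_sub_lt_one_of_floor_eq_floor hi
            simp only [PiLp.sub_apply, PiLp.smul_apply, smul_eq_mul, Real.norm_eq_abs]
            rw [abs_sub_comm]
            exact pow_le_one₀ (abs_nonneg _) this.le
        _ = n := by simp
    have hwA := hωA k₀ w hw
    apply mul_le_mul _ _ (Real.exp_pos _).le (by positivity)
    · rw [h2km]
      exact Real.rpow_le_rpow hξ0.le (by linarith) (by linarith)
    · apply Real.exp_le_exp.2
      rw [neg_div, neg_le_neg_iff, div_le_iff₀ (by have := hwA.1; positivity)]
      have : ‖ξ - (2 : ℝ) ^ k₀ • w‖ ^ 2 ≤ 2 ^ k₀ * n := by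
        have := gpu_scale n (s k₀) (hs0 k₀) ξ w
        rw [← hs2] at this
        rw [this]
        gcongr
      have h3 : (2 : ℝ) ^ k₀ * n * 1 ≤ 2 ^ k₀ * n * (2 * ‖w‖) := by
        gcongr; linarith [hwA.1]
      linarith
  · -- upper bound
    set D : ℝ := (4 * ‖ξ‖) ^ (2 * m) with hD
    have hD0 : 0 ≤ D := by positivity
    set J : Finset ℕ := Finset.Icc (k₀ - 1) (k₀ + 1) with hJ
    have hJc : (J.card : ℝ) ≤ 3 := by
      have : J.card ≤ 3 := by simp only [hJ, Nat.card_Icc]; omega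
      exact_mod_cast this
    have hind : HasSum (fun k => if k ∈ J then D else 0) (J.card * D) := by
      have := hasSum_sum_of_ne_finset_zero (f := fun k => if k ∈ J then D else 0) (s := J) (L := SummationFilter.unconditional ℕ)
        (fun k hk => by simp [hk])
      simpa [Finset.sum_ite_mem] using this
    have hwsum := (hind.add hbs.hasSum).mul_left K
    have hterm : ∀ k, (∑ v ∈ ω k, (2 : ℝ) ^ (2 * (k : ℝ) * m) *
        Real.exp (-‖ξ - (2 : ℝ) ^ k • v‖ ^ 2 / (2 * ((2 : ℝ) ^ k * ‖v‖)))) ≤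
        K * ((if k ∈ J then D else 0) + b k) := by
      intro k
      have hR : (0 : ℝ) < 2 ^ k := by positivity
      set B : ℝ := (if k ∈ J then D else 0) + b k with hB
      have hpt : ∀ v ∈ ω k, (2 : ℝ) ^ (2 * (k : ℝ) * m) *
          Real.exp (-‖ξ - (2 : ℝ) ^ k • v‖ ^ 2 / (2 * ((2 : ℝ) ^ k * ‖v‖))) ≤
          B * Real.exp (-(‖(s k)⁻¹ • ξ - s k • v‖ ^ 2 / 4)) := by
        intro v hv
        obtain ⟨hv1, hv2⟩ := hωA k v hv
        have hsc : ‖(s k)⁻¹ • ξ - s k • v‖ ^ 2 / 4 = ‖ξ - (2 : ℝ) ^ k • v‖ ^ 2 / (4 * 2 ^ k) := by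
          rw [hs2, gpu_scale n (s k) (hs0 k)]
          have := (hs0 k).ne'
          field_simp
        rw [hsc]
        set q := ‖ξ - (2 : ℝ) ^ k • v‖ ^ 2 with hq
        have hq0 : 0 ≤ q := by positivity
        have hsplit : Real.exp (-q / (2 * ((2 : ℝ) ^ k * ‖v‖))) ≤
            Real.exp (-(q / (4 * 2 ^ k))) * Real.exp (-(q / (4 * 2 ^ k))) := by
          rw [← Real.exp_add]
          apply Real.exp_le_exp.2
          have h1 : q / (2 * 2 ^ k) ≤ q / (2 * ((2 : ℝ) ^ k * ‖v‖)) := by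
            apply div_le_div_of_nonneg_left hq0 (by have : 0 < ‖v‖ := by linarith
                                                    positivity)
            nlinarith
          have h2 : q / (2 * 2 ^ k) = q / (4 * 2 ^ k) + q / (4 * 2 ^ k) := by
            field_simp; ring
          rw [neg_div]; linarith
        have hmain : (2 : ℝ) ^ (2 * (k : ℝ) * m) * Real.exp (-(q / (4 * 2 ^ k))) ≤ B := by
          by_cases hfar : (2 : ℝ) ^ k ≤ ‖ξ‖ / 2 ∨ 4 * ‖ξ‖ ≤ 2 ^ k
          · have hp : ‖(2 : ℝ) ^ k • v‖ = 2 ^ k * ‖v‖ := by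
              rw [norm_smul, Real.norm_of_nonneg hR.le]
            have := gpu_far ((2 : ℝ) ^ k) hR ξ ((2 : ℝ) ^ k • v)
              (by rw [hp]; nlinarith) (by rw [hp]; nlinarith) hfar
            calc _ ≤ b k := by simp only [hb]; gcongr
              _ ≤ B := le_add_of_nonneg_left (by split_ifs <;> simp [hD0])
          · push Not at hfar
            have hkJ : k ∈ J := by
              have h1 : (2 : ℝ) ^ k₀ < 2 ^ (k + 2) := by
                rw [pow_add]; linarith
              have h2 : (2 : ℝ) ^ k < 2 ^ (k₀ + 2) := by
                rw [pow_add]; linarith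
              have h1 := (pow_lt_pow_iff_right₀ (one_lt_two)).1 h1
              have h2 := (pow_lt_pow_iff_right₀ (one_lt_two)).1 h2
              simp only [hJ, Finset.mem_Icc]; omega
            have h3 : Real.exp (-(q / (4 * 2 ^ k))) ≤ 1 :=
              Real.exp_le_one_iff.2 (by have : 0 ≤ q / (4 * 2 ^ k) := by positivity
                                        linarith)
            calc _ ≤ (2 : ℝ) ^ (2 * (k : ℝ) * m) * 1 := by gcongr
              _ ≤ D := by
                rw [mul_one, h2km]
                exact Real.rpow_le_rpow hR.le hfar.2.le (by linarith)
              _ ≤ B := by simp only [hB, hkJ, if_true]; linarith [hb0 k]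
        calc _ ≤ (2 : ℝ) ^ (2 * (k : ℝ) * m) *
              (Real.exp (-(q / (4 * 2 ^ k))) * Real.exp (-(q / (4 * 2 ^ k)))) := by gcongr
          _ = ((2 : ℝ) ^ (2 * (k : ℝ) * m) * Real.exp (-(q / (4 * 2 ^ k)))) *
              Real.exp (-(q / (4 * 2 ^ k))) := by ring
          _ ≤ _ := by gcongr
      have hB0 : 0 ≤ B := add_nonneg (by split_ifs <;> simp [hD0]) (hb0 k)
      calc _ ≤ ∑ v ∈ ω k, B * Real.exp (-(‖(s k)⁻¹ • ξ - s k • v‖ ^ 2 / 4)) :=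
            Finset.sum_le_sum hpt
        _ = B * ∑ v ∈ ω k, Real.exp (-(‖(s k)⁻¹ • ξ - s k • v‖ ^ 2 / 4)) :=
            (Finset.mul_sum _ _ _).symm
        _ ≤ B * K := by
            apply mul_le_mul_of_nonneg_left _ hB0
            exact gpu_gauss_sum n (s k) (ω k) (hωinj k) _
        _ = K * B := mul_comm _ _
    calc _ ≤ ∑' k, ENNReal.ofReal (K * ((if k ∈ J then D else 0) + b k)) := by
          apply ENNReal.tsum_le_tsum
          intro k
          rw [← ENNReal.ofReal_sum_of_nonneg (fun v _ => by positivity)]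
          exact ENNReal.ofReal_le_ofReal (hterm k)
      _ = ENNReal.ofReal (K * (J.card * D + S)) := by
          rw [← ENNReal.ofReal_tsum_of_nonneg _ hwsum.summable, hwsum.tsum_eq]
          intro k
          exact mul_nonneg hK0 (add_nonneg (by split_ifs <;> simp [hD0]) (hb0 k))
      _ ≤ _ := by
          apply ENNReal.ofReal_le_ofReal
          have hDe : D = 4 ^ (2 * m) * ‖ξ‖ ^ (2 * m) :=
            Real.mul_rpow (by norm_num) hξ0.le
          have h1 : 1 ≤ (2 : ℝ) ^ (2 * m) * ‖ξ‖ ^ (2 * m) := by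
            rw [← Real.mul_rpow (by norm_num) hξ0.le]
            exact Real.one_le_rpow (by linarith) (by linarith)
          have h2 : J.card * D + S ≤
              (3 * 4 ^ (2 * m) + S * 2 ^ (2 * m)) * ‖ξ‖ ^ (2 * m) := by
            have h3 := mul_le_mul_of_nonneg_right hJc hD0
            have h4 := mul_le_mul_of_nonneg_left h1 hS0
            rw [hDe] at h3 ⊢
            linarith
          have h5 := mul_le_mul_of_nonneg_left h2 hK0
          have h6 : 0 ≤ Real.exp (-n) * ‖ξ‖ ^ (2 * m) := by positivity
          linarith
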